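/- Let G be a spray on an open set U ⊆ ℝⁿ (n ≥ 2) and set R := (1/(n−1)) R^m_m. Then G is of scalar curvature, i.e., Rⁱ_k = R δⁱ_k − τ_k yⁱ for some functions τ_k positively homogeneous of degree 1 in y with τ_k y^k = R, if and only if Rⁱ_k = R δⁱ_k − (1/2) R_{·k} yⁱ − (3/(n+1)) χ_k yⁱ. -/

import Mathlib

open scoped BigOperators

noncomputable section

/-- Points/vectors in local coordinates on an open subset of `ℝⁿ`. -/
abbrev Vec (n : ℕ) := Fin n → ℝ

variable {n : ℕ}

/-- Partial derivative in the base (`x`) variable, in the `k`-th coordinate direction. -/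
noncomputable def pdx (f : Vec n → Vec n → ℝ) (k : Fin n) (x y : Vec n) : ℝ :=
  fderiv ℝ (fun x' => f x' y) x (Pi.single k 1)

/-- Partial derivative in the fiber (`y`) variable, in the `k`-th coordinate direction;
this is the operation denoted by a subscript `·k`. -/
noncomputable def pdy (f : Vec n → Vec n → ℝ) (k : Fin n) (x y : Vec n) : ℝ :=
  fderiv ℝ (fun y' => f x y') y (Pi.single k 1)

/-- Partial derivative of a function of `x` alone. -/
noncomputable def pd (f : Vec n → ℝ) (k : Fin n) (x : Vec n) : ℝ :=
  fderiv ℝ f x (Pi.single k 1)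

/-- `G` is a spray on the open set `U ⊆ ℝⁿ`: the coefficients `Gⁱ(x,y)` are smooth for
`x ∈ U`, `y ≠ 0`, and positively homogeneous of degree `2` in `y`. -/
def IsSpray (U : Set (Vec n)) (G : Fin n → Vec n → Vec n → ℝ) : Prop :=
  (∀ i, ContDiffOn ℝ (⊤ : ℕ∞) (fun p : Vec n × Vec n => G i p.1 p.2)
      (U ×ˢ {y : Vec n | y ≠ 0})) ∧
  (∀ i (x y : Vec n) (lam : ℝ), 0 < lam → G i x (lam • y) = lam ^ 2 * G i x y)

/-- `N^i_j := ∂G^i/∂y^j`. -/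
noncomputable def Nc (G : Fin n → Vec n → Vec n → ℝ) (i j : Fin n) (x y : Vec n) : ℝ :=
  pdy (G i) j x y

/-- `Γ^i_{jk} := ∂²G^i/∂y^j∂y^k`. -/
noncomputable def Ga (G : Fin n → Vec n → Vec n → ℝ) (i j k : Fin n) (x y : Vec n) : ℝ :=
  pdy (Nc G i j) k x y

/-- The horizontal derivative `δf/δx^k := ∂f/∂x^k − N^m_k ∂f/∂y^m`; for a scalar `f` this is
also the horizontal covariant derivative `f_{|k}`. -/
noncomputable def hd (G : Fin n → Vec n → Vec n → ℝ) (f : Vec n → Vec n → ℝ)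
    (k : Fin n) (x y : Vec n) : ℝ :=
  pdx f k x y - ∑ m, Nc G m k x y * pdy f m x y

/-- The four-index Riemann curvature tensor
`R_j{}^i{}_{kl} := δΓⁱ_{jl}/δx^k − δΓⁱ_{jk}/δx^l + Γⁱ_{ks}Γ^s_{jl} − Γ^s_{jk}Γⁱ_{ls}`. -/
noncomputable def Riem4 (G : Fin n → Vec n → Vec n → ℝ) (j i k l : Fin n)
    (x y : Vec n) : ℝ :=
  hd G (Ga G i j l) k x y - hd G (Ga G i j k) l x y
    + ∑ s, (Ga G i k s x y * Ga G s j l x y - Ga G s j k x y * Ga G i l s x y)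

/-- The two-index Riemann curvature `R^i_k := y^j R_j{}^i{}_{kl} y^l`. -/
noncomputable def Riem2 (G : Fin n → Vec n → Vec n → ℝ) (i k : Fin n)
    (x y : Vec n) : ℝ :=
  ∑ j, ∑ l, y j * Riem4 G j i k l x y * y l

/-- The χ-curvature `χ_k := −(1/6)(2 R^m_{k·m} + R^m_{m·k})`. -/
noncomputable def chi (G : Fin n → Vec n → Vec n → ℝ) (k : Fin n) (x y : Vec n) : ℝ :=
  -(1 / 6) * (2 * ∑ m, pdy (Riem2 G m k) m x y + ∑ m, pdy (Riem2 G m m) k x y)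

/-- The scalar `R := (1/(n−1)) R^m_m`. -/
noncomputable def Rsc (G : Fin n → Vec n → Vec n → ℝ) (x y : Vec n) : ℝ :=
  (1 / ((n : ℝ) - 1)) * ∑ m, Riem2 G m m x y

/-- `Π := ∂G^m/∂y^m`. -/
noncomputable def PiG (G : Fin n → Vec n → Vec n → ℝ) (x y : Vec n) : ℝ :=
  ∑ m, Nc G m m x y

/-- The S-curvature of `(G, dV)` for the volume form `dV = σ(x) dx¹⋯dxⁿ`:
`S := Π − y^m ∂(ln σ)/∂x^m`. -/
noncomputable def Scurv (G : Fin n → Vec n → Vec n → ℝ) (σ : Vec n → ℝ)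
    (x y : Vec n) : ℝ :=
  PiG G x y - ∑ m, y m * pd (fun x' => Real.log (σ x')) m x

/-- The spray `Ĝ` associated with `(G, dV)`: `Ĝⁱ := Gⁱ − (S/(n+1)) yⁱ`. -/
noncomputable def Ghat (G : Fin n → Vec n → Vec n → ℝ) (σ : Vec n → ℝ)
    (i : Fin n) (x y : Vec n) : ℝ :=
  G i x y - (Scurv G σ x y / ((n : ℝ) + 1)) * y i

/-- `σ` is the (positive, smooth) density of a volume form `dV = σ(x) dx¹⋯dxⁿ` on `U`. -/
def IsVolumeForm (U : Set (Vec n)) (σ : Vec n → ℝ) : Prop :=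
  ContDiffOn ℝ (⊤ : ℕ∞) σ U ∧ ∀ x ∈ U, 0 < σ x

/-- `G` is of isotropic curvature on `U`: `Rⁱ_k = R δⁱ_k − (1/2) R_{·k} yⁱ`. -/
def IsIsotropicCurv (U : Set (Vec n)) (G : Fin n → Vec n → Vec n → ℝ) : Prop :=
  ∀ x ∈ U, ∀ y : Vec n, y ≠ 0 → ∀ i k,
    Riem2 G i k x y
      = Rsc G x y * (if i = k then 1 else 0) - (1 / 2) * pdy (Rsc G) k x y * y i

/-- `G` is of scalar curvature on `U`: `Rⁱ_k = R δⁱ_k − τ_k yⁱ` for some functions `τ_k`,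
positively homogeneous of degree one in `y`, with `τ_k y^k = R`. -/
def IsScalarCurv (U : Set (Vec n)) (G : Fin n → Vec n → Vec n → ℝ) : Prop :=
  ∃ τ : Fin n → Vec n → Vec n → ℝ,
    (∀ k (x y : Vec n) (lam : ℝ), 0 < lam → τ k x (lam • y) = lam * τ k x y) ∧
    ∀ x ∈ U, ∀ y : Vec n, y ≠ 0 →
      (∑ k, τ k x y * y k) = Rsc G x y ∧
      ∀ i k, Riem2 G i k x y
        = Rsc G x y * (if i = k then 1 else 0) - τ k x y * y i

/-- `f` is positively homogeneous of degree `d` in the fiber variable. -/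
def IsPosHomog (d : ℤ) (f : Vec n → Vec n → ℝ) : Prop :=
  ∀ (x y : Vec n) (lam : ℝ), 0 < lam → f x (lam • y) = lam ^ d * f x y

namespace IsPosHomog

variable {d e : ℤ} {f g : Vec n → Vec n → ℝ}

lemma pdy (hf : IsPosHomog d f) (k : Fin n) : IsPosHomog (d - 1) (pdy f k) := by
  intro x y lam hlam
  have h : (fun y' => f x (lam • y')) = lam ^ d • fun y' => f x y' := by
    ext y'; simp [hf x y' lam hlam]
  have h₁ := congrArg (fun F => fderiv ℝ F y (Pi.single k 1)) h
  simp only [fderiv_const_smul_field, fderiv_comp_smul, FunLike.coe_smul,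
    Pi.smul_apply, smul_eq_mul] at h₁
  rw [zpow_sub_one₀ hlam.ne']
  simp only [_root_.pdy]
  field_simp
  rw [mul_comm]
  exact h₁

lemma pdx (hf : IsPosHomog d f) (k : Fin n) : IsPosHomog d (pdx f k) := by
  intro x y lam hlam
  have h : (fun x' => f x' (lam • y)) = lam ^ d • fun x' => f x' y := by
    ext x'; simp [hf x' y lam hlam]
  simp only [_root_.pdx, h, fderiv_const_smul_field, FunLike.coe_smul,
    Pi.smul_apply, smul_eq_mul]

lemma add (hf : IsPosHomog d f) (hg : IsPosHomog d g) :
    IsPosHomog d (fun x y => f x y + g x y) := by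
  intro x y lam hlam
  simp only [hf x y lam hlam, hg x y lam hlam, mul_add]

lemma sub (hf : IsPosHomog d f) (hg : IsPosHomog d g) :
    IsPosHomog d (fun x y => f x y - g x y) := by
  intro x y lam hlam
  simp only [hf x y lam hlam, hg x y lam hlam, mul_sub]

lemma mul (hf : IsPosHomog d f) (hg : IsPosHomog e g) :
    IsPosHomog (d + e) (fun x y => f x y * g x y) := by
  intro x y lam hlam
  simp only [hf x y lam hlam, hg x y lam hlam, zpow_add₀ hlam.ne']
  ring

lemma const_mul (hf : IsPosHomog d f) (c : ℝ) : IsPosHomog d (fun x y => c * f x y) := by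
  intro x y lam hlam
  simp only [hf x y lam hlam]
  ring

lemma sum {ι : Type*} {s : Finset ι} {F : ι → Vec n → Vec n → ℝ}
    (hF : ∀ i, IsPosHomog d (F i)) : IsPosHomog d (fun x y => ∑ i ∈ s, F i x y) := by
  intro x y lam hlam
  simp only [hF _ x y lam hlam, Finset.mul_sum]

lemma coord (i : Fin n) : IsPosHomog 1 (fun _ y : Vec n => y i) := by
  intro x y lam _
  simp

/-- Euler's identity. -/
lemma sum_pdy_mul (hf : IsPosHomog d f) {x y : Vec n}
    (hd : DifferentiableAt ℝ (fun y' => f x y') y) :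
    ∑ m, _root_.pdy f m x y * y m = d * f x y := by
  have hsum : ∑ m, _root_.pdy f m x y * y m = fderiv ℝ (fun y' => f x y') y y := by
    conv_rhs => rw [pi_eq_sum_univ' y]
    rw [map_sum]
    refine Finset.sum_congr rfl fun m _ => ?_
    rw [map_smul, smul_eq_mul, mul_comm, _root_.pdy]
    congr 3
    ext j
    simp [Pi.single_apply]
  have h₁ : HasDerivAt (fun t : ℝ => f x (t • y)) (fderiv ℝ (fun y' => f x y') y y) 1 := by
    have hl : HasDerivAt (fun t : ℝ => t • y) y 1 := by
      simpa using (hasDerivAt_id (1 : ℝ)).smul_const y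
    have hF : HasFDerivAt (fun y' => f x y') (fderiv ℝ (fun y' => f x y') y) ((1 : ℝ) • y) := by
      rw [one_smul]; exact hd.hasFDerivAt
    exact hF.comp_hasDerivAt (1 : ℝ) hl
  have h₂ : HasDerivAt (fun t : ℝ => f x (t • y)) (d * f x y) 1 := by
    have h := (hasDerivAt_zpow d (1 : ℝ) (Or.inl one_ne_zero)).mul_const (f x y)
    rw [one_zpow, mul_one] at h
    refine h.congr_of_eventuallyEq ?_
    filter_upwards [lt_mem_nhds (zero_lt_one' ℝ)] with t ht
    exact hf x y t ht
  rw [hsum, h₁.unique h₂]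

end IsPosHomog

/-- Joint smoothness of `f` in both variables over `U`, away from the zero section. -/
def SmoothOff (U : Set (Vec n)) (f : Vec n → Vec n → ℝ) : Prop :=
  ContDiffOn ℝ (⊤ : ℕ∞) (fun p : Vec n × Vec n => f p.1 p.2) (U ×ˢ {y : Vec n | y ≠ 0})

lemma isOpen_prod_ne_zero {U : Set (Vec n)} (hU : IsOpen U) :
    IsOpen (U ×ˢ {y : Vec n | y ≠ 0}) :=
  hU.prod isOpen_ne

namespace SmoothOff

variable {U : Set (Vec n)} {f g : Vec n → Vec n → ℝ}

lemma differentiableAt (hU : IsOpen U) (hf : SmoothOff U f) {x y : Vec n} (hx : x ∈ U)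
    (hy : y ≠ 0) : DifferentiableAt ℝ (fun p : Vec n × Vec n => f p.1 p.2) (x, y) :=
  (hf.differentiableOn (by simp)).differentiableAt
    ((isOpen_prod_ne_zero hU).mem_nhds ⟨hx, hy⟩)

lemma differentiableAt_right (hU : IsOpen U) (hf : SmoothOff U f) {x y : Vec n} (hx : x ∈ U)
    (hy : y ≠ 0) : DifferentiableAt ℝ (fun y' => f x y') y :=
  (hf.differentiableAt hU hx hy).comp y (hasFDerivAt_prodMk_right x y).differentiableAt

lemma fderiv_apply (hU : IsOpen U) (hf : SmoothOff U f) (v : Vec n × Vec n) :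
    ContDiffOn ℝ (⊤ : ℕ∞)
      (fun p => fderiv ℝ (fun p : Vec n × Vec n => f p.1 p.2) p v)
      (U ×ˢ {y : Vec n | y ≠ 0}) :=
  (ContDiffOn.fderiv_of_isOpen hf (isOpen_prod_ne_zero hU) (by simp)).clm_apply contDiffOn_const

lemma pdy (hU : IsOpen U) (hf : SmoothOff U f) (k : Fin n) : SmoothOff U (pdy f k) := by
  refine (hf.fderiv_apply hU (0, Pi.single k 1)).congr fun p hp => ?_
  have h : HasFDerivAt (fun y' => f p.1 y') _ p.2 :=
    (hf.differentiableAt hU hp.1 hp.2).hasFDerivAt.comp p.2 (hasFDerivAt_prodMk_right p.1 p.2)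
  simp [_root_.pdy, h.fderiv]

lemma pdx (hU : IsOpen U) (hf : SmoothOff U f) (k : Fin n) : SmoothOff U (pdx f k) := by
  refine (hf.fderiv_apply hU (Pi.single k 1, 0)).congr fun p hp => ?_
  have h : HasFDerivAt (fun x' => f x' p.2) _ p.1 :=
    HasFDerivAt.comp (f := fun x' => (x', p.2)) p.1
      (hf.differentiableAt hU hp.1 hp.2).hasFDerivAt (hasFDerivAt_prodMk_left p.1 p.2)
  simp [_root_.pdx, h.fderiv]

lemma add (hf : SmoothOff U f) (hg : SmoothOff U g) : SmoothOff U (fun x y => f x y + g x y) :=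
  ContDiffOn.add hf hg

lemma sub (hf : SmoothOff U f) (hg : SmoothOff U g) : SmoothOff U (fun x y => f x y - g x y) :=
  ContDiffOn.sub hf hg

lemma mul (hf : SmoothOff U f) (hg : SmoothOff U g) : SmoothOff U (fun x y => f x y * g x y) :=
  ContDiffOn.mul hf hg

lemma sum {ι : Type*} {s : Finset ι} {F : ι → Vec n → Vec n → ℝ}
    (hF : ∀ i, SmoothOff U (F i)) : SmoothOff U (fun x y => ∑ i ∈ s, F i x y) :=
  ContDiffOn.sum fun i _ => hF i

lemma coord (i : Fin n) : SmoothOff U (fun _ y : Vec n => y i) :=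
  ((contDiff_apply ℝ ℝ i).comp contDiff_snd).contDiffOn

end SmoothOff

section Spray

variable {U : Set (Vec n)} {G : Fin n → Vec n → Vec n → ℝ}

namespace IsSpray

lemma isPosHomog (hG : IsSpray U G) (i : Fin n) : IsPosHomog 2 (G i) := by
  intro x y lam hlam
  exact_mod_cast hG.2 i x y lam hlam

lemma isPosHomog_Nc (hG : IsSpray U G) (i j : Fin n) : IsPosHomog 1 (Nc G i j) :=
  (hG.isPosHomog i).pdy j

lemma isPosHomog_Ga (hG : IsSpray U G) (i j k : Fin n) : IsPosHomog 0 (Ga G i j k) :=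
  (hG.isPosHomog_Nc i j).pdy k

lemma isPosHomog_hd (hG : IsSpray U G) {d : ℤ} {f : Vec n → Vec n → ℝ} (hf : IsPosHomog d f)
    (k : Fin n) : IsPosHomog d (hd G f k) := by
  refine (hf.pdx k).sub (IsPosHomog.sum fun m => ?_)
  have h := (hG.isPosHomog_Nc m k).mul (hf.pdy m)
  rwa [add_sub_cancel] at h

lemma isPosHomog_Riem4 (hG : IsSpray U G) (j i k l : Fin n) : IsPosHomog 0 (Riem4 G j i k l) :=
  ((hG.isPosHomog_hd (hG.isPosHomog_Ga i j l) k).sub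
    (hG.isPosHomog_hd (hG.isPosHomog_Ga i j k) l)).add
    (IsPosHomog.sum fun s => ((hG.isPosHomog_Ga i k s).mul (hG.isPosHomog_Ga s j l)).sub
      ((hG.isPosHomog_Ga s j k).mul (hG.isPosHomog_Ga i l s)))

lemma isPosHomog_Riem2 (hG : IsSpray U G) (i k : Fin n) : IsPosHomog 2 (Riem2 G i k) :=
  IsPosHomog.sum fun j => IsPosHomog.sum fun l =>
    ((IsPosHomog.coord j).mul (hG.isPosHomog_Riem4 j i k l)).mul (IsPosHomog.coord l)

lemma isPosHomog_Rsc (hG : IsSpray U G) : IsPosHomog 2 (Rsc G) :=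
  (IsPosHomog.sum fun m => hG.isPosHomog_Riem2 m m).const_mul _

lemma isPosHomog_chi (hG : IsSpray U G) (k : Fin n) : IsPosHomog 1 (chi G k) :=
  (((IsPosHomog.sum fun m => (hG.isPosHomog_Riem2 m k).pdy m).const_mul 2).add
    (IsPosHomog.sum fun m => (hG.isPosHomog_Riem2 m m).pdy k)).const_mul _

lemma smoothOff_Nc (hU : IsOpen U) (hG : IsSpray U G) (i j : Fin n) : SmoothOff U (Nc G i j) :=
  SmoothOff.pdy hU (hG.1 i) j

lemma smoothOff_Ga (hU : IsOpen U) (hG : IsSpray U G) (i j k : Fin n) :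
    SmoothOff U (Ga G i j k) :=
  (hG.smoothOff_Nc hU i j).pdy hU k

lemma smoothOff_hd (hU : IsOpen U) (hG : IsSpray U G) {f : Vec n → Vec n → ℝ}
    (hf : SmoothOff U f) (k : Fin n) : SmoothOff U (hd G f k) :=
  (hf.pdx hU k).sub (SmoothOff.sum fun m => (hG.smoothOff_Nc hU m k).mul (hf.pdy hU m))

lemma smoothOff_Riem4 (hU : IsOpen U) (hG : IsSpray U G) (j i k l : Fin n) :
    SmoothOff U (Riem4 G j i k l) :=
  ((hG.smoothOff_hd hU (hG.smoothOff_Ga hU i j l) k).sub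
    (hG.smoothOff_hd hU (hG.smoothOff_Ga hU i j k) l)).add
    (SmoothOff.sum fun s => ((hG.smoothOff_Ga hU i k s).mul (hG.smoothOff_Ga hU s j l)).sub
      ((hG.smoothOff_Ga hU s j k).mul (hG.smoothOff_Ga hU i l s)))

lemma smoothOff_Riem2 (hU : IsOpen U) (hG : IsSpray U G) (i k : Fin n) :
    SmoothOff U (Riem2 G i k) :=
  SmoothOff.sum fun j => SmoothOff.sum fun l =>
    ((SmoothOff.coord j).mul (hG.smoothOff_Riem4 hU j i k l)).mul (SmoothOff.coord l)

end IsSpray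

lemma sum_Riem2_self (hn : 2 ≤ n) (x y : Vec n) :
    ∑ m, Riem2 G m m x y = ((n : ℝ) - 1) * Rsc G x y := by
  have hn' : (2 : ℝ) ≤ n := by exact_mod_cast hn
  have h : (n : ℝ) - 1 ≠ 0 := by linarith
  rw [Rsc]
  field_simp

/-- In the scalar form `Rⁱ_k = R δⁱ_k − τ_k yⁱ`, the normalization `τ_k y^k = R` is automatic. -/
lemma sum_mul_eq_Rsc (hn : 2 ≤ n) {x y : Vec n} {t : Fin n → ℝ}
    (h : ∀ i k, Riem2 G i k x y = Rsc G x y * (if i = k then 1 else 0) - t k * y i) :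
    ∑ k, t k * y k = Rsc G x y := by
  have h₁ := sum_Riem2_self (G := G) hn x y
  simp only [h, if_true, mul_one, Finset.sum_sub_distrib, Finset.sum_const, Finset.card_univ,
    Fintype.card_fin, nsmul_eq_mul] at h₁
  linarith

/-- The covector `τ_k` of a spray of scalar curvature is `½ R_{·k} + 3/(n+1) χ_k`. -/
lemma scalar_covector_eq (hn : 2 ≤ n) (hU : IsOpen U) (hG : IsSpray U G)
    {τ : Fin n → Vec n → Vec n → ℝ} (hτ : ∀ k, IsPosHomog 1 (τ k)) {x : Vec n} (hx : x ∈ U)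
    (h : ∀ y : Vec n, y ≠ 0 → ∀ i k,
      Riem2 G i k x y = Rsc G x y * (if i = k then 1 else 0) - τ k x y * y i)
    {y : Vec n} (hy : y ≠ 0) (k : Fin n) :
    τ k x y = 1 / 2 * pdy (Rsc G) k x y + 3 / ((n : ℝ) + 1) * chi G k x y := by
  have hdRiem (i j : Fin n) : DifferentiableAt ℝ (fun y' => Riem2 G i j x y') y :=
    (hG.smoothOff_Riem2 hU i j).differentiableAt_right hU hx hy
  have hdR : DifferentiableAt ℝ (fun y' => Rsc G x y') y :=
    (DifferentiableAt.fun_sum fun m _ => hdRiem m m).const_mul _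
  have hdcoord (i : Fin n) : DifferentiableAt ℝ (fun y' : Vec n => y' i) y :=
    differentiableAt_apply i y
  have hne : ∀ᶠ y' : Vec n in nhds y, y' ≠ 0 := isOpen_ne.mem_nhds hy
  have hdτ : DifferentiableAt ℝ (fun y' => τ k x y') y := by
    obtain ⟨i, hi⟩ := Function.ne_iff.mp hy
    refine (((hdR.mul_const (if i = k then (1 : ℝ) else 0)).fun_sub (hdRiem i k)).fun_mul
      ((hdcoord i).fun_inv hi)).congr_of_eventuallyEq ?_
    filter_upwards [hne, (hdcoord i).continuousAt.eventually_ne hi] with y' hy' hi'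
    rw [h y' hy' i k, sub_sub_cancel, mul_inv_cancel_right₀ hi']
  have hpdy (m : Fin n) : pdy (Riem2 G m k) m x y
      = pdy (Rsc G) m x y * (if m = k then 1 else 0) - (pdy (τ k) m x y * y m + τ k x y) := by
    have heq : (fun y' => Riem2 G m k x y') =ᶠ[nhds y]
        fun y' => Rsc G x y' * (if m = k then 1 else 0) - τ k x y' * y' m := by
      filter_upwards [hne] with y' hy' using h y' hy' m k
    have hF := (hdR.hasFDerivAt.mul_const (if m = k then (1 : ℝ) else 0)).fun_sub
      (hdτ.hasFDerivAt.fun_mul (hasFDerivAt_apply (𝕜 := ℝ) m y))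
    simp only [pdy]
    rw [heq.fderiv_eq, hF.fderiv]
    split_ifs <;> simp <;> ring
  have htrace : ∑ m, pdy (Riem2 G m m) k x y = ((n : ℝ) - 1) * pdy (Rsc G) k x y := by
    have h₁ : fderiv ℝ (fun y' => ∑ m, Riem2 G m m x y') y
        = ((n : ℝ) - 1) • fderiv ℝ (fun y' => Rsc G x y') y := by
      simp only [sum_Riem2_self hn]
      exact fderiv_const_mul hdR _
    rw [fderiv_fun_sum fun m _ => hdRiem m m] at h₁
    simpa [pdy] using congrArg (fun L => L (Pi.single k 1)) h₁
  have heuler := (hτ k).sum_pdy_mul hdτ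
  have hn' : (n : ℝ) + 1 ≠ 0 := by positivity
  rw [chi, htrace]
  simp only [hpdy, Finset.sum_sub_distrib, Finset.sum_add_distrib, heuler, Finset.sum_const,
    Finset.card_univ, Fintype.card_fin, nsmul_eq_mul, mul_ite, mul_one, mul_zero,
    Finset.sum_ite_eq', Finset.mem_univ, if_true]
  push_cast
  field_simp
  ring

end Spray

/-- `G` is of scalar curvature iff
`Rⁱ_k = R δⁱ_k − (1/2) R_{·k} yⁱ − (3/(n+1)) χ_k yⁱ`. -/
theorem scalar_curvature_iff_chi_formula
    {n : ℕ} (hn : 2 ≤ n) (U : Set (Vec n)) (hU : IsOpen U)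
    (G : Fin n → Vec n → Vec n → ℝ) (hG : IsSpray U G) :
    IsScalarCurv U G ↔
      ∀ x ∈ U, ∀ y : Vec n, y ≠ 0 → ∀ i k,
        Riem2 G i k x y
          = Rsc G x y * (if i = k then 1 else 0)
            - (1 / 2) * pdy (Rsc G) k x y * y i
            - (3 / ((n : ℝ) + 1)) * chi G k x y * y i := by
  constructor
  · rintro ⟨τ, hτ, h⟩ x hx y hy i k
    have hτ' (k : Fin n) : IsPosHomog 1 (τ k) := fun x y lam hlam => by
      simpa using hτ k x y lam hlam
    rw [(h x hx y hy).2 i k,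
      scalar_covector_eq hn hU hG hτ' hx (fun y hy => (h x hx y hy).2) hy k]
    ring
  · intro h
    refine ⟨fun k x y => 1 / 2 * pdy (Rsc G) k x y + 3 / ((n : ℝ) + 1) * chi G k x y,
      fun k x y lam hlam => ?_, fun x hx y hy => ?_⟩
    · have hhom := ((hG.isPosHomog_Rsc.pdy k).const_mul (1 / 2)).add
        ((hG.isPosHomog_chi k).const_mul (3 / ((n : ℝ) + 1)))
      simpa using hhom x y lam hlam
    · have hform (i k : Fin n) : Riem2 G i k x y = Rsc G x y * (if i = k then 1 else 0)
          - (1 / 2 * pdy (Rsc G) k x y + 3 / ((n : ℝ) + 1) * chi G k x y) * y i := by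
        rw [h x hx y hy i k]
        ring
      exact ⟨sum_mul_eq_Rsc hn hform, hform⟩
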